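/- Projectives cogenerate for all finite dimensional algebras if and only if projective cogeneration is left-right symmetric. Precisely: (for every field k and every finite dimensional k-algebra Λ, projectives cogenerate for Λ) if and only if (for every field k and every finite dimensional k-algebra Λ, projectives cogenerate for Λ implies projectives cogenerate for Λᵒᵖ). -/

import Mathlib

universe u

open CategoryTheory Limits Pretriangulated

/-- `ProjectivesCogenerate Λ` : projectives cogenerate for the ring `Λ`, i.e. the
smallest triangulated subcategory of the unbounded derived category of right
`Λ`-modules that contains all the projective modules and is closed under set-indexed
products is the whole derived category.  Subcategories are encoded as sets of objects
`S` which are closed under isomorphism, shifts, extensions (hence are triangulated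
subcategories) and products. -/
def ProjectivesCogenerate (Λ : Type u) [Ring Λ] : Prop :=
  letI : HasDerivedCategory (ModuleCat.{u} Λᵐᵒᵖ) := HasDerivedCategory.standard _
  ∀ S : Set (DerivedCategory (ModuleCat.{u} Λᵐᵒᵖ)),
    (∀ X Y, (X ≅ Y) → X ∈ S → Y ∈ S) →
    (∀ X ∈ S, ∀ m : ℤ, X⟦m⟧ ∈ S) →
    (∀ T ∈ distinguishedTriangles, T.obj₁ ∈ S → T.obj₃ ∈ S → T.obj₂ ∈ S) →
    (∀ (I : Type u) (f : I → DerivedCategory (ModuleCat.{u} Λᵐᵒᵖ)) (c : Fan f),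
      IsLimit c → (∀ i, f i ∈ S) → c.pt ∈ S) →
    (∀ M : ModuleCat.{u} Λᵐᵒᵖ, Projective M →
      (DerivedCategory.singleFunctor (ModuleCat.{u} Λᵐᵒᵖ) 0).obj M ∈ S) →
    ∀ X, X ∈ S

universe w

namespace PCG
section
variable {R : Type u} [Ring R]

abbrev Cx (R : Type u) [Ring R] := CochainComplex (ModuleCat.{u} R) ℤ

lemma quasiIso_iff_elem {K L : Cx R} (f : K ⟶ L) :
    QuasiIso f ↔ ∀ i : ℤ,
      (∀ (x : K.X i) (y : L.X (i-1)), K.d i (i+1) x = 0 → f.f i x = L.d (i-1) i y →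
        ∃ z : K.X (i-1), x = K.d (i-1) i z) ∧
      (∀ y : L.X i, L.d i (i+1) y = 0 → ∃ x : K.X i, K.d i (i+1) x = 0 ∧
        ∃ z : L.X (i-1), y = f.f i x + L.d (i-1) i z) := by
  have key : ∀ i : ℤ, QuasiIsoAt f i ↔
      Mono (HomologicalComplex.homologyMap f i) ∧ Epi (HomologicalComplex.homologyMap f i) := by
    intro i
    rw [quasiIsoAt_iff_isIso_homologyMap]
    exact isIso_iff_mono_and_epi _
  rw [quasiIso_iff]
  refine forall_congr' fun i => ?_
  rw [key, HomologicalComplex.mono_homologyMap_iff_up_to_refinements f (i-1) i (i+1) (by simp) (by simp),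
    HomologicalComplex.epi_homologyMap_iff_up_to_refinements f (i-1) i (i+1) (by simp) (by simp)]
  refine and_congr ⟨fun h x y hx hxy => ?_, fun h A x hx y hxy => ?_⟩
    ⟨fun h y hy => ?_, fun h A y hy => ?_⟩
  · obtain ⟨A', π, hπ, z, hz⟩ := h (A := ModuleCat.of R R)
      (ModuleCat.ofHom (LinearMap.toSpanSingleton R _ x))
      (by ext; simpa using hx) (ModuleCat.ofHom (LinearMap.toSpanSingleton R _ y))
      (by ext; simpa using hxy)
    obtain ⟨a, ha⟩ := (ModuleCat.epi_iff_surjective π).1 hπ (1 : R)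
    refine ⟨z a, ?_⟩
    have := congr($hz a)
    simp only [ModuleCat.comp_apply, ha] at this
    simpa using this
  · choose g hg using fun a : A => h (x a) (y a) (by simpa using congr($hx a)) (by simpa using congr($hxy a))
    refine ⟨ModuleCat.of R (A →₀ R), ModuleCat.ofHom (Finsupp.linearCombination R id), ?_,
      ModuleCat.ofHom (Finsupp.linearCombination R g), ?_⟩
    · rw [ModuleCat.epi_iff_surjective]
      exact Finsupp.linearCombination_id_surjective R A
    · ext a
      simp [← hg]
  · obtain ⟨A', π, hπ, x, hx, z, hz⟩ := h (A := ModuleCat.of R R)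
      (ModuleCat.ofHom (LinearMap.toSpanSingleton R _ y)) (by ext; simpa using hy)
    obtain ⟨a, ha⟩ := (ModuleCat.epi_iff_surjective π).1 hπ (1 : R)
    refine ⟨x a, by simpa using congr($hx a), z a, ?_⟩
    have := congr($hz a)
    simp only [ModuleCat.comp_apply, ha] at this
    simpa using this
  · choose g hg g' hg' using fun a : A => h (y a) (by simpa using congr($hy a))
    refine ⟨ModuleCat.of R (A →₀ R), ModuleCat.ofHom (Finsupp.linearCombination R id), ?_,
      ModuleCat.ofHom (Finsupp.linearCombination R g), ?_,
      ModuleCat.ofHom (Finsupp.linearCombination R g'), ?_⟩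
    · rw [ModuleCat.epi_iff_surjective]
      exact Finsupp.linearCombination_id_surjective R A
    · ext a
      simp [hg]
    · ext a
      simp [← hg']

/-- explicit product complex -/
@[simps]
def piC {I : Type u} (K : I → Cx R) : Cx R where
  X i := ModuleCat.of R (∀ a, (K a).X i)
  d i j := ModuleCat.ofHom (LinearMap.pi fun a => ((K a).d i j).hom ∘ₗ LinearMap.proj a)
  shape i j h := by
    refine ModuleCat.hom_ext (LinearMap.ext fun x => funext fun a => ?_)
    exact congr($((K a).shape i j h) (x a))
  d_comp_d' i j k _ _ := by
    refine ModuleCat.hom_ext (LinearMap.ext fun x => funext fun a => ?_)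
    exact congr($((K a).d_comp_d i j k) (x a))

def piProj {I : Type u} (K : I → Cx R) (a : I) : piC K ⟶ K a where
  f i := ModuleCat.ofHom (LinearMap.proj a)
  comm' i j _ := rfl

def piLift {I : Type u} (K : I → Cx R) {X : Cx R} (f : ∀ a, X ⟶ K a) : X ⟶ piC K where
  f i := ModuleCat.ofHom (LinearMap.pi fun a => ((f a).f i).hom)
  comm' i j _ := by
    refine ModuleCat.hom_ext (LinearMap.ext fun x => funext fun a => ?_)
    exact congr($((f a).comm i j) x)

lemma piLift_proj {I : Type u} (K : I → Cx R) {X : Cx R} (f : ∀ a, X ⟶ K a) (a : I) :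
    piLift K f ≫ piProj K a = f a := by
  ext i x; rfl

lemma pi_ext {I : Type u} (K : I → Cx R) {X : Cx R} {f g : X ⟶ piC K}
    (h : ∀ a, f ≫ piProj K a = g ≫ piProj K a) : f = g := by
  ext i x
  funext a
  exact congr(($(h a)).f i x)

def piMap {I : Type u} {K L : I → Cx R} (f : ∀ a, K a ⟶ L a) : piC K ⟶ piC L :=
  piLift L fun a => piProj K a ≫ f a

lemma piMap_quasiIso {I : Type u} {K L : I → Cx R} (f : ∀ a, K a ⟶ L a)
    (h : ∀ a, QuasiIso (f a)) : QuasiIso (piMap f) := by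
  rw [quasiIso_iff_elem]
  intro i
  have h' := fun a => (quasiIso_iff_elem (f a)).1 (h a) i
  refine ⟨fun x y hx hxy => ?_, fun y hy => ?_⟩
  · choose z hz using fun a => (h' a).1 (x a) (y a) (congrFun hx a) (congrFun hxy a)
    exact ⟨z, funext hz⟩
  · choose x hx z hz using fun a => (h' a).2 (y a) (congrFun hy a)
    exact ⟨x, funext hx, z, funext hz⟩

end

section
variable {R : Type u} [Ring R] [HasDerivedCategory.{w} (ModuleCat.{u} R)]
open DerivedCategory

lemma Q_map_eq_zero {K L : Cx R} (g : K ⟶ L) (h : Q.map g = 0) :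
    ∃ (L' : Cx R) (s : L ⟶ L') (_ : QuasiIso s), Nonempty (Homotopy (g ≫ s) 0) := by
  have h1 : Qh.map ((HomotopyCategory.quotient _ _).map g) = Qh.map 0 := by
    have := quotientCompQhIso_hom_naturality g
    rw [h, comp_zero] at this
    rw [Functor.map_zero]
    exact (cancel_mono _).1 (this.trans zero_comp.symm)
  rw [MorphismProperty.map_eq_iff_postcomp Qh (HomotopyCategory.quasiIso (ModuleCat.{u} R) (ComplexShape.up ℤ))] at h1
  obtain ⟨L', s, hs, hh⟩ := h1
  obtain ⟨L', rfl⟩ := HomotopyCategory.quotient_obj_surjective L'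
  obtain ⟨s, rfl⟩ := (HomotopyCategory.quotient _ _).map_surjective s
  rw [HomotopyCategory.quotient_map_mem_quasiIso_iff] at hs
  refine ⟨L', s, hs, ⟨HomotopyCategory.homotopyOfEq _ _ ?_⟩⟩
  simpa using hh

def piHomAux {I : Type u} {K : Cx R} {L : I → Cx R} (i j : ℤ)
    (h : ∀ a, K.X i ⟶ (L a).X j) : K.X i ⟶ (piC L).X j :=
  ModuleCat.ofHom (LinearMap.pi fun a => (h a).hom)

def piHomotopy {I : Type u} {K : Cx R} {L : I → Cx R} (f : K ⟶ piC L)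
    (h : ∀ a, Homotopy (f ≫ piProj L a) 0) : Homotopy f 0 where
  hom i j := piHomAux i j fun a => (h a).hom i j
  zero i j hij := by
    refine ModuleCat.hom_ext (LinearMap.ext fun x => funext fun a => ?_)
    exact congr($((h a).zero i j hij) x)
  comm i := by
    rw [dNext_eq _ (show (ComplexShape.up ℤ).Rel i (i+1) by simp),
      prevD_eq _ (show (ComplexShape.up ℤ).Rel (i-1) i by simp)]
    refine ModuleCat.hom_ext (LinearMap.ext fun x => funext fun a => ?_)
    have := congr($((h a).comm i) x)
    simp only [dNext_eq (h a).hom (show (ComplexShape.up ℤ).Rel i (i+1) by simp),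
      prevD_eq (h a).hom (show (ComplexShape.up ℤ).Rel (i-1) i by simp)] at this
    exact this

lemma pi_hom_ext {I : Type u} (K : I → Cx R) {X : DerivedCategory (ModuleCat.{u} R)}
    (f : X ⟶ Q.obj (piC K)) (h : ∀ a, f ≫ Q.map (piProj K a) = 0) : f = 0 := by
  obtain ⟨Y, ⟨e⟩⟩ : ∃ Y, Nonempty (Q.obj Y ≅ X) := ⟨_, ⟨Q.objObjPreimageIso X⟩⟩
  rw [← cancel_epi e.hom, comp_zero]
  obtain ⟨X', s, hs, g, hg⟩ := right_fac (e.hom ≫ f)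
  rw [hg]
  suffices Q.map g = 0 by rw [this, comp_zero]
  have h2 : ∀ a, Q.map (g ≫ piProj K a) = 0 := by
    intro a
    rw [← cancel_epi (inv (Q.map s)), Q.map_comp, ← Category.assoc, ← hg, Category.assoc, h,
      comp_zero, comp_zero]
  choose L t ht hh using fun a => Q_map_eq_zero _ (h2 a)
  have : QuasiIso (piMap t) := piMap_quasiIso t ht
  rw [← cancel_mono (Q.map (piMap t)), zero_comp, ← Q.map_comp, ← Q.map_zero]
  refine Q_map_eq_of_homotopy _ (piHomotopy _ fun a => ?_)
  refine (Homotopy.ofEq ?_).trans (hh a).some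
  simp [piMap, piLift_proj]

lemma pi_hom_ext' {I : Type u} (K : I → Cx R) {X : DerivedCategory (ModuleCat.{u} R)}
    (f g : X ⟶ Q.obj (piC K)) (h : ∀ a, f ≫ Q.map (piProj K a) = g ≫ Q.map (piProj K a)) :
    f = g := by
  rw [← sub_eq_zero]
  apply pi_hom_ext
  intro a
  rw [Preadditive.sub_comp, h, sub_self]

noncomputable def piFan {I : Type u} (K : I → Cx R) : Fan (fun a => Q.obj (K a)) :=
  Fan.mk (Q.obj (piC K)) fun a => Q.map (piProj K a)

lemma piFan_exists {I : Type u} (K : I → Cx R) {X : DerivedCategory (ModuleCat.{u} R)}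
    (f : ∀ a, X ⟶ Q.obj (K a)) : ∃ g : X ⟶ Q.obj (piC K), ∀ a, g ≫ Q.map (piProj K a) = f a := by
  obtain ⟨Y, ⟨e⟩⟩ : ∃ Y, Nonempty (Q.obj Y ≅ X) := ⟨_, ⟨Q.objObjPreimageIso X⟩⟩
  choose L g s hs hf using fun a => left_fac (e.hom ≫ f a)
  have hs' : ∀ a, QuasiIso (s a) := fun a => (isIso_Q_map_iff_quasiIso _ _).1 (hs a)
  have : QuasiIso (piMap s) := piMap_quasiIso s hs'
  refine ⟨e.inv ≫ Q.map (piLift L g) ≫ inv (Q.map (piMap s)), fun a => ?_⟩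
  rw [← cancel_epi e.hom, ← cancel_mono (Q.map (s a)), hf]
  have : piProj K a ≫ s a = piMap s ≫ piProj L a := (piLift_proj _ _ _).symm
  simp only [Category.assoc, e.hom_inv_id_assoc, ← Q.map_comp, this]
  simp only [Q.map_comp, IsIso.inv_hom_id_assoc]
  rw [← Q.map_comp, piLift_proj]
  simp

noncomputable def piFanIsLimit {I : Type u} (K : I → Cx R) : IsLimit (piFan K) :=
  Fan.IsLimit.mk _ (fun s => (piFan_exists K (fun a => s.proj a)).choose)
    (fun s => (piFan_exists K (fun a => s.proj a)).choose_spec)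
    (fun s m hm => pi_hom_ext' K _ _ fun a =>
      (hm a).trans ((piFan_exists K (fun a => s.proj a)).choose_spec a).symm)
end
end PCG

namespace PCG
section
variable {R : Type u} [Ring R] [HasDerivedCategory.{w} (ModuleCat.{u} R)]
open DerivedCategory

structure IsColoc (S : Set (DerivedCategory (ModuleCat.{u} R))) : Prop where
  iso : ∀ X Y, (X ≅ Y) → X ∈ S → Y ∈ S
  shift : ∀ X ∈ S, ∀ m : ℤ, X⟦m⟧ ∈ S
  ext : ∀ T ∈ distinguishedTriangles, T.obj₁ ∈ S → T.obj₃ ∈ S → T.obj₂ ∈ S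
  prod : ∀ (I : Type u) (f : I → DerivedCategory (ModuleCat.{u} R)) (c : Fan f),
      IsLimit c → (∀ i, f i ∈ S) → c.pt ∈ S

lemma shortExact_mk {A B C : Cx R} (f : A ⟶ B) (g : B ⟶ C)
    (hf : ∀ i, Function.Injective (f.f i)) (hg : ∀ i, Function.Surjective (g.f i))
    (h0 : ∀ i x, g.f i (f.f i x) = 0)
    (hex : ∀ i (y : B.X i), g.f i y = 0 → ∃ x, f.f i x = y) :
    ∃ h : f ≫ g = 0, (ShortComplex.mk f g h).ShortExact := by
  have h : f ≫ g = 0 := by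
    ext i x
    exact h0 i x
  refine ⟨h, HomologicalComplex.shortExact_of_degreewise_shortExact _ fun i => ?_⟩
  refine ModuleCat.shortComplex_shortExact _ ?_ (hf i) (hg i)
  intro y
  exact ⟨fun hy => hex i y hy, by rintro ⟨x, rfl⟩; exact h0 i x⟩

namespace IsColoc
variable {S : Set (DerivedCategory (ModuleCat.{u} R))} (hS : IsColoc S)
include hS

lemma pi {I : Type u} (K : I → Cx R) (h : ∀ a, Q.obj (K a) ∈ S) : Q.obj (piC K) ∈ S :=
  hS.prod I _ _ (piFanIsLimit K) h

lemma quasi {K L : Cx R} (f : K ⟶ L) (hf : QuasiIso f) : Q.obj K ∈ S ↔ Q.obj L ∈ S :=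
  ⟨hS.iso _ _ (asIso (Q.map f)), hS.iso _ _ (asIso (Q.map f)).symm⟩

lemma ext₁ (T : Triangle (DerivedCategory (ModuleCat.{u} R))) (hT : T ∈ distinguishedTriangles)
    (h2 : T.obj₂ ∈ S) (h3 : T.obj₃ ∈ S) : T.obj₁ ∈ S :=
  hS.ext _ (inv_rot_of_distTriang _ hT) (hS.shift _ h3 (-1)) h2

section
variable {A B C : Cx R} (f : A ⟶ B) (g : B ⟶ C)
    (hf : ∀ i, Function.Injective (f.f i)) (hg : ∀ i, Function.Surjective (g.f i))
    (h0 : ∀ i x, g.f i (f.f i x) = 0)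
    (hex : ∀ i (y : B.X i), g.f i y = 0 → ∃ x, f.f i x = y)
include hf hg h0 hex

lemma ses₂ (h1 : Q.obj A ∈ S) (h3 : Q.obj C ∈ S) : Q.obj B ∈ S := by
  obtain ⟨h, hse⟩ := shortExact_mk f g hf hg h0 hex
  exact hS.ext _ (triangleOfSES_distinguished hse) h1 h3

lemma ses₁ (h2 : Q.obj B ∈ S) (h3 : Q.obj C ∈ S) : Q.obj A ∈ S := by
  obtain ⟨h, hse⟩ := shortExact_mk f g hf hg h0 hex
  exact hS.ext₁ _ (triangleOfSES_distinguished hse) h2 h3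
end

lemma zero (X : DerivedCategory (ModuleCat.{u} R)) (hX : IsZero X) : X ∈ S :=
  hS.prod PEmpty (fun a => a.elim) (Fan.mk X fun a => a.elim)
    (Fan.IsLimit.mk _ (fun s => 0) (fun s a => a.elim) (fun s m hm => hX.eq_of_tgt _ _))
    (fun a => a.elim)

/-- inverse limits of towers -/
lemma lim (Z : ℕ → Cx R) (p : ∀ n, Z (n+1) ⟶ Z n) (K : Cx R) (q : ∀ n, K ⟶ Z n)
    (hq : ∀ n, q (n+1) ≫ p n = q n)
    (hinj : ∀ i (x : K.X i), (∀ n, (q n).f i x = 0) → x = 0)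
    (hlim : ∀ i (x : ∀ n, (Z n).X i), (∀ n, (p n).f i (x (n+1)) = x n) → ∃ y, ∀ n, (q n).f i y = x n)
    (hml : ∀ i (y : ∀ n, (Z n).X i), ∃ x : ∀ n, (Z n).X i, ∀ n, x n - (p n).f i (x (n+1)) = y n)
    (hZ : ∀ n, Q.obj (Z n) ∈ S) : Q.obj K ∈ S := by
  let Z' : ULift.{u} ℕ → Cx R := fun n => Z n.down
  let f : K ⟶ piC Z' := piLift Z' fun n => q n.down
  let g : piC Z' ⟶ piC Z' := piLift Z' fun n =>
    piProj Z' n - piProj Z' ⟨n.down + 1⟩ ≫ p n.down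
  have hgx : ∀ i (x : (piC Z').X i) n, g.f i x n = x n - (p n.down).f i (x ⟨n.down + 1⟩) := by
    intro i x n
    rfl
  have hfx : ∀ i (x : K.X i) n, f.f i x n = (q n.down).f i x := by
    intro i x n
    rfl
  refine hS.ses₁ f g ?_ ?_ ?_ ?_ (hS.pi _ fun a => hZ _) (hS.pi _ fun a => hZ _)
  · intro i
    rw [injective_iff_map_eq_zero]
    intro x hx
    refine hinj i x fun n => ?_
    rw [← hfx i x ⟨n⟩, hx]
    rfl
  · intro i y
    obtain ⟨x, hx⟩ := hml i (fun n => y ⟨n⟩)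
    let z : (piC Z').X i := fun n => x n.down
    exact ⟨z, funext fun n => (hgx i z n).trans (hx n.down)⟩
  · intro i x
    funext n
    rw [hgx, hfx, hfx]
    have := congr(($(hq n.down)).f i x)
    change _ = (0 : (Z' n).X i)
    rw [sub_eq_zero]
    exact this.symm
  · intro i y hy
    obtain ⟨x, hx⟩ := hlim i (fun n => y ⟨n⟩) (fun n => by
      have := congrFun hy ⟨n⟩
      rw [hgx] at this
      exact (sub_eq_zero.1 this).symm)
    exact ⟨x, funext fun n => by rw [hfx]; exact hx _⟩

lemma retract {K L : Cx R} (i : K ⟶ L) (r : L ⟶ K) (h : i ≫ r = 𝟙 K) (hL : Q.obj L ∈ S) :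
    Q.obj K ∈ S := by
  have hr : ∀ j (x : K.X j), r.f j (i.f j x) = x := fun j x => congr(($h).f j x)
  refine hS.lim (fun _ => L) (fun _ => r ≫ i) K (fun _ => i) (fun n => ?_) ?_ ?_ ?_ (fun _ => hL)
  · rw [← Category.assoc, h, Category.id_comp]
  · intro j x hx
    rw [← hr j x, hx 0, map_zero]
  · intro j x hx
    have hx' : ∀ n, i.f j (r.f j (x (n+1))) = x n := hx
    refine ⟨r.f j (x 0), fun n => ?_⟩
    have h1 : ∀ n, r.f j (x n) = r.f j (x 0) := by
      intro n
      induction n with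
      | zero => rfl
      | succ n ih => rw [← ih, ← hx' n, hr]
    rw [← hx' n, h1 (n+1)]
  · intro j y
    let s : ℕ → K.X j := fun n => -∑ m ∈ Finset.range n, r.f j (y m)
    refine ⟨fun n => (y n - i.f j (r.f j (y n))) + i.f j (s n), fun n => ?_⟩
    have hs : s (n+1) = s n - r.f j (y n) := by
      simp only [s, Finset.sum_range_succ]
      abel
    change _ - i.f j (r.f j _) = _
    simp only [map_add, map_sub, hr, hs]
    abel

lemma single_iff (n : ℤ) (M : ModuleCat.{u} R) :
    (singleFunctor _ n).obj M ∈ S ↔ (singleFunctor _ 0).obj M ∈ S := by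
  constructor
  · intro h
    exact hS.iso _ _ (((singleFunctors _).shiftIso n 0 n (by simp)).app M) (hS.shift _ h n)
  · intro h
    exact hS.iso _ _ (((singleFunctors _).shiftIso (-n) n 0 (by simp)).app M) (hS.shift _ h (-n))

lemma single_retract {M N : ModuleCat.{u} R} (i : M →ₗ[R] N) (r : N →ₗ[R] M)
    (h : ∀ x, r (i x) = x) (hN : (singleFunctor _ 0).obj N ∈ S) :
    (singleFunctor _ 0).obj M ∈ S := by
  refine hS.retract (K := (HomologicalComplex.single _ (ComplexShape.up ℤ) 0).obj M)
    (L := (HomologicalComplex.single _ (ComplexShape.up ℤ) 0).obj N)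
    ((HomologicalComplex.single _ (ComplexShape.up ℤ) 0).map (ModuleCat.ofHom i))
    ((HomologicalComplex.single _ (ComplexShape.up ℤ) 0).map (ModuleCat.ofHom r)) ?_ hN
  have h' : (ModuleCat.ofHom i : M ⟶ N) ≫ (ModuleCat.ofHom r : N ⟶ M) = 𝟙 M := by
    ext x
    exact h x
  exact ((HomologicalComplex.single _ (ComplexShape.up ℤ) 0).map_comp _ _).symm.trans
    ((congrArg _ h').trans ((HomologicalComplex.single _ (ComplexShape.up ℤ) 0).map_id _))

lemma of_zero_diff (X : Cx R) (hX : ∀ i j, X.d i j = 0)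
    (h : ∀ i, (singleFunctor _ 0).obj (X.X i) ∈ S) : Q.obj X ∈ S := by
  let K : ULift.{u} ℤ → Cx R := fun a => (HomologicalComplex.single _ _ a.down).obj (X.X a.down)
  let φ : ∀ a, X ⟶ K a := fun a =>
    HomologicalComplex.mkHomToSingle (𝟙 _) (fun i _ => by rw [hX, zero_comp])
  have hφ : ∀ i : ℤ, (φ ⟨i⟩).f i =
      (HomologicalComplex.singleObjXSelf (ComplexShape.up ℤ) i (X.X i)).inv := by
    intro i
    exact (HomologicalComplex.mkHomToSingle_f _ _).trans (Category.id_comp _)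
  let f : X ⟶ piC K := piLift K φ
  have hb : ∀ i, Function.Bijective (f.f i) := by
    intro i
    have hfi : ∀ x, f.f i x ⟨i⟩ =
      (HomologicalComplex.singleObjXSelf (ComplexShape.up ℤ) i (X.X i)).inv x := by
        intro x
        exact congr($(hφ i) x)
    constructor
    · intro x y hxy
      have h1 := congrFun hxy ⟨i⟩
      rw [hfi, hfi] at h1
      exact (ConcreteCategory.bijective_of_isIso (HomologicalComplex.singleObjXSelf (ComplexShape.up ℤ) i (X.X i)).inv).1 h1
    · intro y
      refine ⟨(HomologicalComplex.singleObjXSelf (ComplexShape.up ℤ) i (X.X i)).hom (y ⟨i⟩), ?_⟩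
      funext a
      by_cases ha : a = ⟨i⟩
      · subst ha
        rw [hfi]
        simp only [← ModuleCat.comp_apply, Iso.hom_inv_id]
        rfl
      · have : Subsingleton ((K a).X i) := by
          apply ModuleCat.subsingleton_of_isZero
          apply HomologicalComplex.isZero_single_obj_X
          rintro rfl
          exact ha rfl
        exact Subsingleton.elim _ _
  have : QuasiIso f := by
    have : ∀ i, IsIso (f.f i) := fun i => (ConcreteCategory.isIso_iff_bijective _).2 (hb i)
    have : IsIso f := HomologicalComplex.Hom.isIso_of_components f
    infer_instance
  rw [hS.quasi f this]
  exact hS.pi _ fun a => (hS.single_iff _ _).2 (h _)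

lemma single_of_zero_diff (X : Cx R) (hX : ∀ i j, X.d i j = 0)
    (h : Q.obj X ∈ S) (i : ℤ) : (singleFunctor _ 0).obj (X.X i) ∈ S := by
  rw [← hS.single_iff i]
  refine hS.retract (K := (HomologicalComplex.single _ _ i).obj (X.X i))
    (HomologicalComplex.mkHomFromSingle (𝟙 _) (fun j _ => by rw [hX, comp_zero]))
    (HomologicalComplex.mkHomToSingle (𝟙 _) (fun j _ => by rw [hX, zero_comp])) ?_ h
  apply HomologicalComplex.from_single_hom_ext
  simp

end IsColoc
end
end PCG

namespace PCG
section
variable {R : Type u} [Ring R]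
open DerivedCategory

def uC (X : Cx R) (U : ∀ i, Submodule R (X.X i)) : Cx R where
  X i := ModuleCat.of R (U i)
  d i j := 0
  shape _ _ _ := rfl
  d_comp_d' _ _ _ _ _ := by simp

def uI (X : Cx R) (U : ∀ i, Submodule R (X.X i)) (hU : ∀ i j, ∀ x ∈ U i, X.d i j x = 0) :
    uC X U ⟶ X where
  f i := ModuleCat.ofHom (U i).subtype
  comm' i j _ := by
    refine ModuleCat.hom_ext (LinearMap.ext fun x => ?_)
    exact hU i j x.1 x.2

lemma uI_quasiIso (X : Cx R) (U : ∀ i, Submodule R (X.X i)) (hU : ∀ i j, ∀ x ∈ U i, X.d i j x = 0)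
    (hd : ∀ i, ∀ x ∈ U i, ∀ y : X.X (i-1), x = X.d (i-1) i y → x = 0)
    (hs : ∀ i (y : X.X i), X.d i (i+1) y = 0 → ∃ x ∈ U i, ∃ z : X.X (i-1), y = x + X.d (i-1) i z) :
    QuasiIso (uI X U hU) := by
  rw [quasiIso_iff_elem]
  intro i
  refine ⟨fun x y hx hxy => ⟨0, ?_⟩, fun y hy => ?_⟩
  · rw [map_zero]
    exact Subtype.ext (hd i x.1 x.2 y hxy)
  · obtain ⟨x, hx, z, h⟩ := hs i y hy
    exact ⟨(⟨x, hx⟩ : U i), rfl, z, h⟩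

section K
variable {N : Type u} [AddCommGroup N] [Module R N] (d : N →ₗ[R] N) (hd : ∀ x, d (d x) = 0)

open Classical in
noncomputable def kd (p : ℤ → Prop) (i j : ℤ) : (PLift (p i) → N) →ₗ[R] (PLift (p j) → N) where
  toFun x _ := if h : i + 1 = j ∧ p i then d (x ⟨h.2⟩) else 0
  map_add' x y := by
    funext t
    by_cases h : i + 1 = j ∧ p i <;> simp [h]
  map_smul' r x := by
    funext t
    by_cases h : i + 1 = j ∧ p i <;> simp [h]

variable (R N) in
open Classical in
noncomputable def km (p q : ℤ → Prop) (i : ℤ) : (PLift (p i) → N) →ₗ[R] (PLift (q i) → N) where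
  toFun x _ := if h : p i then x ⟨h⟩ else 0
  map_add' x y := by
    funext t
    by_cases h : p i <;> simp [h]
  map_smul' r x := by
    funext t
    by_cases h : p i <;> simp [h]

noncomputable def kC (p : ℤ → Prop) : Cx R where
  X i := ModuleCat.of R (PLift (p i) → N)
  d i j := ModuleCat.ofHom (kd d p i j)
  shape i j h := by
    refine ModuleCat.hom_ext (LinearMap.ext fun x => funext fun t => ?_)
    exact dif_neg (fun h' => h h'.1)
  d_comp_d' i j k _ _ := by
    refine ModuleCat.hom_ext (LinearMap.ext fun x => funext fun t => ?_)
    change (kd d p j k (kd d p i j x)) t = 0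
    by_cases h : i + 1 = j ∧ p i <;> by_cases h' : j + 1 = k ∧ p j <;> simp [kd, h, h', hd]

noncomputable def kM (p q : ℤ → Prop) (h : ∀ i, p i → q (i+1) → (q i ↔ p (i+1))) : kC d hd p ⟶ kC d hd q where
  f i := ModuleCat.ofHom (km R N p q i)
  comm' i j hij := by
    refine ModuleCat.hom_ext (LinearMap.ext fun x => funext fun t => ?_)
    change kd d q i j (km R N p q i x) t = km R N p q j (kd d p i j x) t
    obtain rfl : i + 1 = j := hij
    have h1 := h i
    have ht := t.down
    by_cases h2 : p i <;> by_cases h3 : q i <;> by_cases h4 : p (i+1) <;>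
      simp_all [kd, km]

lemma kC_proj [Module.Projective R N] (p : ℤ → Prop) (i : ℤ) : Projective ((kC d hd p).X i) := by
  change Projective (ModuleCat.of R (PLift (p i) → N))
  rw [← IsProjective.iff_projective]
  by_cases h : p i
  · have : Unique (PLift (p i)) := ⟨⟨⟨h⟩⟩, fun _ => rfl⟩
    exact Module.Projective.of_equiv (LinearEquiv.funUnique (PLift (p i)) R N).symm
  · have : IsEmpty (PLift (p i)) := ⟨fun t => h t.down⟩
    infer_instance

end K

section
variable [HasDerivedCategory.{w} (ModuleCat.{u} R)]
  {S : Set (DerivedCategory (ModuleCat.{u} R))} (hS : IsColoc S)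
include hS

lemma IsColoc.uC_iff (X : Cx R) (U : ∀ i, Submodule R (X.X i)) (hU : ∀ i j, ∀ x ∈ U i, X.d i j x = 0)
    (hd : ∀ i, ∀ x ∈ U i, ∀ y : X.X (i-1), x = X.d (i-1) i y → x = 0)
    (hs : ∀ i (y : X.X i), X.d i (i+1) y = 0 → ∃ x ∈ U i, ∃ z : X.X (i-1), y = x + X.d (i-1) i z) :
    Q.obj X ∈ S ↔ ∀ i, (singleFunctor _ 0).obj (ModuleCat.of R (U i)) ∈ S := by
  rw [← hS.quasi _ (uI_quasiIso X U hU hd hs)]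
  exact ⟨fun h i => hS.single_of_zero_diff (uC X U) (fun _ _ => rfl) h i,
    fun h => hS.of_zero_diff (uC X U) (fun _ _ => rfl) h⟩

variable (hP : ∀ M : ModuleCat.{u} R, Projective M → (singleFunctor _ 0).obj M ∈ S)
  {N : Type u} [AddCommGroup N] [Module R N] (d : N →ₗ[R] N) (hd : ∀ x, d (d x) = 0)
  [Module.Projective R N]
include hP

lemma IsColoc.kC_zero (p : ℤ → Prop) (h : ∀ i, ¬ (p i ∧ p (i+1))) :
    Q.obj (kC d hd p) ∈ S := by
  refine hS.of_zero_diff _ (fun i j => ?_) (fun i => hP _ (kC_proj d hd p i))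
  refine ModuleCat.hom_ext (LinearMap.ext fun x => funext fun t => ?_)
  refine dif_neg fun h' => h i ⟨h'.2, ?_⟩
  rw [h'.1]
  exact t.down

lemma IsColoc.kC_trunc (n : ℕ) : Q.obj (kC d hd fun i => 0 ≤ i ∧ i < n) ∈ S := by
  induction n with
  | zero => exact hS.kC_zero hP d hd _ (fun i => by push_cast; omega)
  | succ n ih =>
    refine hS.ses₂ (kM d hd (fun i => i = n) (fun i => 0 ≤ i ∧ i < (n+1 : ℕ)) (fun i => by push_cast; omega))
      (kM d hd (fun i => 0 ≤ i ∧ i < (n+1 : ℕ)) (fun i => 0 ≤ i ∧ i < n) (fun i => by push_cast; omega))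
      ?_ ?_ ?_ ?_ (hS.kC_zero hP d hd _ (fun i => by omega)) ih
    · intro i x y hxy
      funext t
      have h1 := t.down
      have := congrFun hxy ⟨by push_cast; omega⟩
      exact (dif_pos h1).symm.trans (this.trans (dif_pos h1))
    · intro i y
      refine ⟨km R N (fun i => 0 ≤ i ∧ i < n) (fun i => 0 ≤ i ∧ i < (n+1 : ℕ)) i y, ?_⟩
      funext t
      have h1 := t.down
      have h2 : (0 ≤ i ∧ i < (n+1:ℕ)) := by push_cast; omega
      exact (dif_pos h2).trans (dif_pos h1)
    · intro i x
      funext t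
      have h1 := t.down
      have h2 : (0 ≤ i ∧ i < (n+1:ℕ)) := by push_cast; omega
      exact (dif_pos h2).trans (dif_neg (by omega))
    · intro i y hy
      refine ⟨km R N (fun i => 0 ≤ i ∧ i < (n+1 : ℕ)) (fun i => i = n) i y, ?_⟩
      funext t
      have h1 := t.down
      by_cases h2 : i = n
      · exact (dif_pos h2).trans (dif_pos h1)
      · refine (dif_neg h2).trans ?_
        have h3 : 0 ≤ i ∧ i < n := by push_cast at h1; omega
        have := congrFun hy ⟨h3⟩
        exact (this.symm.trans (dif_pos h1))

lemma IsColoc.kC_pos : Q.obj (kC d hd fun i => 0 ≤ i) ∈ S := by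
  refine hS.lim (fun n => kC d hd fun i => 0 ≤ i ∧ i < n)
    (fun n => kM d hd (fun i => 0 ≤ i ∧ i < (n+1 : ℕ)) (fun i => 0 ≤ i ∧ i < n) (fun i => by push_cast; omega))
    _ (fun n => kM d hd (fun i => 0 ≤ i) (fun i => 0 ≤ i ∧ i < n) (fun i => by omega)) ?_ ?_ ?_ ?_
    (fun n => hS.kC_trunc hP d hd n)
  · intro n
    refine HomologicalComplex.Hom.ext (funext fun i => ModuleCat.hom_ext (LinearMap.ext fun x => funext fun t => ?_))
    have h1 := t.down
    have h2 : (0 ≤ i ∧ i < (n+1:ℕ)) := by push_cast; omega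
    exact dif_pos h2
  · intro i x hx
    funext t
    have h1 := t.down
    have := congrFun (hx (i.toNat + 1)) ⟨by push_cast; omega⟩
    exact (dif_pos h1).symm.trans this
  · intro i x hx
    have key : ∀ (h0 : 0 ≤ i) (n : ℕ) (hn : i.toNat + 1 ≤ n), 
        ((x n : PLift (0 ≤ i ∧ i < n) → N) ⟨by omega⟩ : N) =
        (x (i.toNat+1) : PLift (0 ≤ i ∧ i < (i.toNat+1 : ℕ)) → N) ⟨by push_cast; omega⟩ := by
      intro h0 n hn
      induction n, hn using Nat.le_induction with
      | base => rfl
      | succ n hn ih =>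
        rw [← ih]
        have := congrFun (hx n) ⟨by omega⟩
        exact (dif_pos (by push_cast; omega)).symm.trans this
    let y : PLift (0 ≤ i) → N := fun t => (x (i.toNat+1) : PLift (0 ≤ i ∧ i < (i.toNat+1 : ℕ)) → N)
      ⟨by have := t.down; push_cast; omega⟩
    refine ⟨y, fun n => funext fun t => ?_⟩
    have h1 := t.down
    exact (dif_pos h1.1).trans (key h1.1 n (by omega)).symm
  · intro i y
    classical
    let y' : ℕ → N := fun m => if h : (0 ≤ i ∧ i < m) then (y m : PLift (0 ≤ i ∧ i < m) → N) ⟨h⟩ else 0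
    let x : ∀ n : ℕ, PLift (0 ≤ i ∧ i < n) → N := fun n _ => - ∑ m ∈ Finset.range n, y' m
    refine ⟨x, fun n => funext fun t => ?_⟩
    have h1 := t.down
    have h2 : (0 ≤ i ∧ i < (n+1:ℕ)) := by push_cast; omega
    refine (congrArg (fun a : N => x n t - a) (dif_pos h2)).trans ?_
    change (- ∑ m ∈ Finset.range n, y' m) - (- ∑ m ∈ Finset.range (n+1), y' m) = _
    rw [Finset.sum_range_succ]
    have : y' n = (y n : PLift (0 ≤ i ∧ i < n) → N) t := dif_pos h1
    rw [← this]
    abel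

end
end
end PCG

namespace PCG
section
variable {R : Type u} [Ring R]
open DerivedCategory

def sC (X : Cx R) (U : ∀ i, Submodule R (X.X i)) (hU : ∀ i j, ∀ x ∈ U i, X.d i j x ∈ U j) : Cx R where
  X i := ModuleCat.of R (U i)
  d i j := ModuleCat.ofHom ((X.d i j).hom.restrict (hU i j))
  shape i j h := by
    refine ModuleCat.hom_ext (LinearMap.ext fun x => Subtype.ext ?_)
    exact congr($(X.shape i j h) x.1)
  d_comp_d' i j k _ _ := by
    refine ModuleCat.hom_ext (LinearMap.ext fun x => Subtype.ext ?_)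
    exact congr($(X.d_comp_d i j k) x.1)

def sI (X : Cx R) (U : ∀ i, Submodule R (X.X i)) (hU : ∀ i j, ∀ x ∈ U i, X.d i j x ∈ U j) :
    sC X U hU ⟶ X where
  f i := ModuleCat.ofHom (U i).subtype
  comm' i j _ := rfl

def qC (X : Cx R) (U : ∀ i, Submodule R (X.X i)) (hU : ∀ i j, ∀ x ∈ U i, X.d i j x ∈ U j) : Cx R where
  X i := ModuleCat.of R (X.X i ⧸ U i)
  d i j := ModuleCat.ofHom ((U i).mapQ (U j) (X.d i j).hom (hU i j))
  shape i j h := by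
    refine ModuleCat.hom_ext (LinearMap.ext fun x => ?_)
    obtain ⟨x, rfl⟩ := (U i).mkQ_surjective x
    exact congrArg (U j).mkQ congr($(X.shape i j h) x)
  d_comp_d' i j k _ _ := by
    refine ModuleCat.hom_ext (LinearMap.ext fun x => ?_)
    obtain ⟨x, rfl⟩ := (U i).mkQ_surjective x
    exact congrArg (U k).mkQ congr($(X.d_comp_d i j k) x)

def qP (X : Cx R) (U : ∀ i, Submodule R (X.X i)) (hU : ∀ i j, ∀ x ∈ U i, X.d i j x ∈ U j) :
    X ⟶ qC X U hU where
  f i := ModuleCat.ofHom (U i).mkQ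
  comm' i j _ := rfl

def cC (M : Type u) [AddCommGroup M] [Module R M] : Cx R where
  X i := ModuleCat.of R M
  d i j := 0
  shape _ _ _ := rfl
  d_comp_d' _ _ _ _ _ := by simp

section
variable [HasDerivedCategory.{w} (ModuleCat.{u} R)]
  {S : Set (DerivedCategory (ModuleCat.{u} R))} (hS : IsColoc S)
include hS

lemma IsColoc.single_pi (M : Type u) [AddCommGroup M] [Module R M] (I : Type u)
    (h : (singleFunctor _ 0).obj (ModuleCat.of R M) ∈ S) :
    (singleFunctor _ 0).obj (ModuleCat.of R (I → M)) ∈ S := by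
  refine hS.single_of_zero_diff (piC fun _ : I => cC M) (fun i j => ?_) (hS.pi _ fun a =>
    hS.of_zero_diff _ (fun _ _ => rfl) fun _ => h) 0
  rfl

lemma IsColoc.sub_quot (X : Cx R) (U : ∀ i, Submodule R (X.X i)) (hU : ∀ i j, ∀ x ∈ U i, X.d i j x ∈ U j)
    (h1 : Q.obj (sC X U hU) ∈ S) (h2 : Q.obj (qC X U hU) ∈ S) : Q.obj X ∈ S := by
  refine hS.ses₂ (sI X U hU) (qP X U hU) ?_ ?_ ?_ ?_ h1 h2
  · intro i
    exact (U i).subtype_injective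
  · intro i
    exact (U i).mkQ_surjective
  · intro i x
    exact (Submodule.Quotient.mk_eq_zero (U i)).2 x.2
  · intro i y hy
    exact ⟨(⟨y, (Submodule.Quotient.mk_eq_zero (U i)).1 hy⟩ : U i), rfl⟩

/-- step (b) -/
lemma IsColoc.range_mem
    (hP : ∀ M : ModuleCat.{u} R, Projective M → (singleFunctor _ 0).obj M ∈ S)
    {N : Type u} [AddCommGroup N] [Module R N] (d : N →ₗ[R] N) (hd : ∀ x, d (d x) = 0)
    [Module.Projective R N] (π : LinearMap.ker d →ₗ[R] LinearMap.range d)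
    (hπ : ∀ x, (π ⟨d x, hd x⟩ : N) = d x) :
    (singleFunctor _ 0).obj (ModuleCat.of R (LinearMap.range d)) ∈ S := by
  classical
  let V : ℤ → Submodule R N := fun i => if i = 0 then LinearMap.ker d else
    (LinearMap.ker π).map (LinearMap.ker d).subtype
  have hV : ∀ i, V i ≤ LinearMap.ker d := by
    intro i
    by_cases h : i = 0
    · simp [V, h]
    · simp only [V, h, if_false]
      exact Submodule.map_subtype_le _ _
  let U : ∀ i, Submodule R ((kC d hd fun i => 0 ≤ i).X i) :=
    fun i => Submodule.pi (R := R) (φ := fun _ : PLift (0 ≤ i) => N) Set.univ fun _ => V i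
  have key := (hS.uC_iff (kC d hd fun i => 0 ≤ i) U ?_ ?_ ?_).1 (hS.kC_pos hP d hd) 0
  · have hV0 : V 0 = LinearMap.ker d := if_pos rfl
    let i : LinearMap.range d →ₗ[R] U 0 :=
      { toFun x := ⟨fun _ => x.1, fun t _ => by
          rw [hV0]; obtain ⟨y, hy⟩ := x.2; rw [← hy]; exact hd y⟩
        map_add' x y := rfl
        map_smul' r x := rfl }
    let t0 : PLift ((0:ℤ) ≤ 0) := ⟨le_rfl⟩
    let r0 : U 0 →ₗ[R] LinearMap.ker d :=
      { toFun x := ⟨(x.1 : PLift ((0:ℤ) ≤ 0) → N) t0, by rw [← hV0]; exact x.2 _ trivial⟩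
        map_add' x y := rfl
        map_smul' r x := rfl }
    refine hS.single_retract (M := ModuleCat.of R (LinearMap.range d)) (N := ModuleCat.of R (U 0)) i (π ∘ₗ r0) ?_ key
    rintro ⟨_, x, rfl⟩
    exact Subtype.ext (hπ x)
  · intro i j x hx
    funext t
    by_cases h : i + 1 = j ∧ 0 ≤ i
    · exact (dif_pos h).trans (hV i (hx _ trivial))
    · exact dif_neg h
  · intro i x hx y hxy
    funext t
    have h0 := t.down
    have h1 := congrFun hxy t
    by_cases h : i = 0
    · exact h1.trans (dif_neg (by omega))
    · have h2 := h1.trans (dif_pos (show i - 1 + 1 = i ∧ 0 ≤ i - 1 by omega))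
      have h3 := hx t trivial
      simp only [V, h, if_false] at h3
      obtain ⟨⟨z, hz⟩, hz', hz''⟩ := h3
      change z = _ at hz''
      rw [← hz''] at h2
      subst h2
      have h4 := hπ (y ⟨by omega⟩)
      refine hz''.symm.trans (h4.symm.trans ?_)
      exact congrArg Subtype.val hz'
  · intro i y hy
    by_cases h : 0 < i
    · have hy' : d ((y : PLift (0 ≤ i) → N) ⟨h.le⟩) = 0 := by
        have := congrFun hy ⟨by omega⟩
        exact (dif_pos ⟨rfl, h.le⟩).symm.trans this
      generalize hy0 : (y : PLift (0 ≤ i) → N) ⟨h.le⟩ = y0 at hy'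
      obtain ⟨n, hn⟩ := (π ⟨y0, hy'⟩).2
      have hw : π (⟨y0, hy'⟩ - ⟨d n, hd n⟩) = 0 := by
        rw [map_sub, sub_eq_zero]
        apply Subtype.ext
        rw [hπ, hn]
      refine ⟨(fun _ => y0 - d n : PLift (0 ≤ i) → N), fun t _ => ?_, (fun _ => n : PLift (0 ≤ i - 1) → N), funext fun t => ?_⟩
      · simp only [V, h.ne', if_false]
        exact ⟨_, hw, rfl⟩
      · refine Eq.trans ?_ (congrArg (fun a : N => (y0 - d n) + a) (dif_pos (show i - 1 + 1 = i ∧ 0 ≤ i - 1 by omega))).symm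
        rw [sub_add_cancel]
        exact hy0
    · refine ⟨y, fun t _ => ?_, 0, by rw [map_zero, add_zero]⟩
      have h0 := t.down
      obtain rfl : i = 0 := by omega
      simp only [V, if_true]
      have := congrFun hy ⟨by omega⟩
      exact (dif_pos ⟨rfl, le_rfl⟩).symm.trans this

variable [IsSemiprimaryRing R]

/-- step (c) -/
lemma IsColoc.single_killed
    (hJ : (singleFunctor _ 0).obj (ModuleCat.of R (R ⧸ Ring.jacobson R)) ∈ S)
    (M : Type u) [AddCommGroup M] [Module R M] (hM : Module.IsTorsionBySet R M (Ring.jacobson R)) :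
    (singleFunctor _ 0).obj (ModuleCat.of R M) ∈ S := by
  let _ := hM.module
  have hMP : Module.Projective (R ⧸ Ring.jacobson R) M := Module.projective_of_isSemisimpleRing _ _
  have hMI : Module.Injective (R ⧸ Ring.jacobson R) M := Module.injective_of_isSemisimpleRing _ _
  obtain ⟨s, hs⟩ := Module.Projective.out (R := R ⧸ Ring.jacobson R) (P := M)
  let i : M →ₗ[R ⧸ Ring.jacobson R] (M → R ⧸ Ring.jacobson R) := Finsupp.lcoeFun ∘ₗ s
  have hi : Function.Injective i := by
    intro x y hxy
    rw [← hs x, ← hs y]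
    congr 1
    exact DFunLike.coe_injective hxy
  obtain ⟨r, hr⟩ := Module.Injective.out i hi LinearMap.id
  exact hS.single_retract (M := ModuleCat.of R M) (N := ModuleCat.of R (M → R ⧸ Ring.jacobson R))
    (i.restrictScalars R) (r.restrictScalars R) hr (hS.single_pi _ _ hJ)

lemma IsColoc.killed_one
    (hJ : (singleFunctor _ 0).obj (ModuleCat.of R (R ⧸ Ring.jacobson R)) ∈ S)
    (X : Cx R) (hX : ∀ i, Module.IsTorsionBySet R (X.X i) (Ring.jacobson R)) : Q.obj X ∈ S := by
  have hss : ∀ i, IsSemisimpleModule R (X.X i) := by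
    intro i
    let _ := (hX i).module
    exact ((hX i).semilinearMap.isSemisimpleModule_iff_of_bijective Function.bijective_id).2
      inferInstance
  have hc : ∀ i, ∃ U : Submodule R (X.X i), U ≤ LinearMap.ker (X.d i (i+1)).hom ∧
      Disjoint U (LinearMap.range (X.d (i-1) i).hom) ∧
      U ⊔ (LinearMap.range (X.d (i-1) i).hom) = LinearMap.ker (X.d i (i+1)).hom := by
    intro i
    obtain ⟨U, hU⟩ := exists_isCompl (LinearMap.range (X.d (i-1) i).hom)
    have hle : LinearMap.range (X.d (i-1) i).hom ≤ LinearMap.ker (X.d i (i+1)).hom := by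
      rintro _ ⟨x, rfl⟩
      exact congr($(X.d_comp_d (i-1) i (i+1)) x)
    refine ⟨U ⊓ LinearMap.ker (X.d i (i+1)).hom, inf_le_right, hU.symm.disjoint.mono_left inf_le_left, ?_⟩
    rw [inf_comm, inf_sup_assoc_of_le _ hle, sup_comm, hU.sup_eq_top, inf_top_eq]
  choose U hU1 hU2 hU3 using hc
  refine (hS.uC_iff X U ?_ ?_ ?_).2 fun i => hS.single_killed hJ _ ?_
  · intro i j x hx
    by_cases h : i + 1 = j
    · subst h
      exact hU1 i hx
    · rw [X.shape i j h]; rfl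
  · intro i x hx y hy
    exact (Submodule.disjoint_def.1 (hU2 i)) x hx ⟨y, hy.symm⟩
  · intro i y hy
    have : y ∈ LinearMap.ker (X.d i (i+1)).hom := hy
    rw [← hU3, Submodule.mem_sup] at this
    obtain ⟨x, hx, _, ⟨z, rfl⟩, h⟩ := this
    exact ⟨x, hx, z, h.symm⟩
  · intro x r
    exact Subtype.ext (@hX i x.1 r)

lemma IsColoc.killed_pow
    (hJ : (singleFunctor _ 0).obj (ModuleCat.of R (R ⧸ Ring.jacobson R)) ∈ S) (n : ℕ)
    (X : Cx R) (hX : ∀ i, ∀ r ∈ Ring.jacobson R ^ n, ∀ x : X.X i, r • x = 0) : Q.obj X ∈ S := by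
  induction n generalizing X with
  | zero =>
    refine hS.killed_one hJ X fun i x r => hX i _ ?_ x
    rw [Submodule.pow_zero, Ideal.one_eq_top]
    trivial
  | succ n ih =>
    refine hS.sub_quot X (fun i => Ring.jacobson R • ⊤) ?_ (ih _ ?_) (hS.killed_one hJ _ ?_)
    · intro i j x hx
      have := Submodule.mem_map_of_mem (f := (X.d i j).hom) hx
      rw [Submodule.map_smul''] at this
      exact Submodule.smul_mono le_rfl le_top this
    · rintro i r hr ⟨x, hx⟩
      apply Subtype.ext
      change r • x = 0
      have h1 : r • x ∈ (Ring.jacobson R ^ n) • (Ring.jacobson R • ⊤ : Submodule R (X.X i)) :=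
        Submodule.smul_mem_smul hr hx
      rw [← Submodule.mul_smul, ← Submodule.pow_succ] at h1
      have h2 : (Ring.jacobson R ^ (n+1)) • (⊤ : Submodule R (X.X i)) ≤ ⊥ := by
        rw [Submodule.smul_le]
        intro r hr x _
        exact hX i r hr x
      exact h2 h1
    · intro i
      exact Module.isTorsionBySet_quotient_ideal_smul _ _

theorem IsColoc.main
    (hJ : (singleFunctor _ 0).obj (ModuleCat.of R (R ⧸ Ring.jacobson R)) ∈ S)
    (X : DerivedCategory (ModuleCat.{u} R)) : X ∈ S := by
  obtain ⟨n, hn⟩ := IsSemiprimaryRing.isNilpotent (R := R)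
  refine hS.iso _ _ (Q.objObjPreimageIso X) (hS.killed_pow hJ n _ ?_)
  intro i r hr x
  rw [hn] at hr
  rw [(show r = 0 from hr), zero_smul]

end
end
end PCG

namespace PCG
section
variable {k B T : Type u} [Field k] [Ring B] [Algebra k B] [Ring T] [Algebra k T]
  (i j : B →ₐ[k] T)

/-- The bimodule `T`, with `B` acting on the left through `i` and on the right through `j`. -/
def Bim (i j : B →ₐ[k] T) : Type u := T

noncomputable instance : AddCommGroup (Bim i j) := inferInstanceAs (AddCommGroup T)
noncomputable instance : Module k (Bim i j) := inferInstanceAs (Module k T)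
noncomputable instance : Module B (Bim i j) := Module.compHom T i.toRingHom
noncomputable instance : Module Bᵐᵒᵖ (Bim i j) := Module.compHom T j.toRingHom.op
instance : SMulCommClass B Bᵐᵒᵖ (Bim i j) :=
  ⟨fun a b t => (mul_assoc (i a) (show T from t) (j b.unop)).symm⟩
instance : IsScalarTower k B (Bim i j) :=
  ⟨fun c a t => by
    change i (c • a) * (show T from t) = c • (i a * (show T from t))
    rw [map_smul, smul_mul_assoc]⟩
instance : IsScalarTower k Bᵐᵒᵖ (Bim i j) :=
  ⟨fun c a t => by
    change (show T from t) * j (c • a.unop) = c • ((show T from t) * j a.unop)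
    rw [map_smul, mul_smul_comm]⟩

abbrev Gam (i j : B →ₐ[k] T) := TrivSqZeroExt B (Bim i j)

noncomputable example : Algebra k (Gam i j) := inferInstance

instance [FiniteDimensional k B] [FiniteDimensional k T] : FiniteDimensional k (Gam i j) :=
  inferInstanceAs (Module.Finite k (B × T))

instance [FiniteDimensional k B] [FiniteDimensional k T] : IsArtinianRing (Gam i j)ᵐᵒᵖ :=
  IsArtinianRing.of_finite k _

/-- second component, as an element of `T` -/
def sn (g : Gam i j) : T := g.snd

def mkG (a : B) (t : T) : Gam i j := (a, t)

lemma ext_G {g h : Gam i j} (h1 : g.fst = h.fst) (h2 : sn i j g = sn i j h) : g = h :=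
  TrivSqZeroExt.ext h1 h2

lemma sn_mul (g h : Gam i j) : sn i j (g * h) = i g.fst * sn i j h + sn i j g * j h.fst := rfl

lemma sn_add (g h : Gam i j) : sn i j (g + h) = sn i j g + sn i j h := rfl

abbrev mm : Gam i j := mkG i j 0 1

noncomputable abbrev dd : (Gam i j)ᵐᵒᵖ →ₗ[(Gam i j)ᵐᵒᵖ] (Gam i j)ᵐᵒᵖ :=
  LinearMap.toSpanSingleton _ _ (MulOpposite.op (mm i j))

lemma mm_mul (g : Gam i j) : mm i j * g = mkG i j 0 (j g.fst) := by
  apply ext_G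
  · exact zero_mul _
  · change i 0 * sn i j g + 1 * j g.fst = _
    rw [map_zero, zero_mul, zero_add, one_mul]
    rfl

lemma dd_apply (x : (Gam i j)ᵐᵒᵖ) : dd i j x = MulOpposite.op (mkG i j 0 (j x.unop.fst)) := by
  rw [← mm_mul]
  rfl

lemma dd_dd (x : (Gam i j)ᵐᵒᵖ) : dd i j (dd i j x) = 0 := by
  rw [dd_apply, dd_apply]
  apply MulOpposite.unop_injective
  apply ext_G
  · rfl
  · exact map_zero j

variable (hj : ∀ a, j a = 0 ↔ a ∈ Ring.jacobson B)
include hj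

lemma mem_ker_dd (x : (Gam i j)ᵐᵒᵖ) : x ∈ LinearMap.ker (dd i j) ↔ x.unop.fst ∈ Ring.jacobson B := by
  rw [LinearMap.mem_ker, dd_apply, ← hj]
  constructor
  · intro h
    exact congrArg (fun x => sn i j x.unop) h
  · intro h
    apply MulOpposite.unop_injective
    apply ext_G
    · rfl
    · exact h

lemma nilp [IsSemiprimaryRing B] (g : Gam i j) (hg : g.fst ∈ Ring.jacobson B) : IsNilpotent g := by
  obtain ⟨n, hn⟩ := IsSemiprimaryRing.isNilpotent (R := B)
  have h1 : g.fst ^ n = 0 := by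
    have := Ideal.pow_mem_pow hg n
    rw [hn] at this
    exact this
  have h2 : (g ^ n).fst = 0 := by rw [TrivSqZeroExt.fst_pow, h1]
  refine ⟨n * 2, ?_⟩
  rw [pow_mul, pow_two]
  apply ext_G
  · rw [TrivSqZeroExt.fst_mul, h2, zero_mul]; rfl
  · rw [sn_mul, h2, map_zero, map_zero, zero_mul, mul_zero, add_zero]; rfl

lemma ker_dd [IsSemiprimaryRing B] : LinearMap.ker (dd i j) = Ring.jacobson (Gam i j)ᵐᵒᵖ := by
  apply le_antisymm
  · intro x hx
    have h1 : Ring.jacobson (Gam i j)ᵐᵒᵖ = Ideal.jacobson ⊥ := Ring.jacobson_eq_sInf_isMaximal _ |>.trans (by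
      simp [Ideal.jacobson])
    rw [h1, Ideal.mem_jacobson_iff]
    intro y
    have h2 : y * x ∈ LinearMap.ker (dd i j) := Submodule.smul_mem _ y hx
    rw [mem_ker_dd i j hj] at h2
    have h3 := nilp i j hj _ h2
    have h4 : IsNilpotent (y * x) := by
      obtain ⟨n, hn⟩ := h3
      exact ⟨n, MulOpposite.unop_injective hn⟩
    obtain ⟨z, hz⟩ := h4.isUnit_one_add.exists_left_inv
    refine ⟨z, ?_⟩
    rw [Ideal.mem_bot, mul_assoc]
    rw [mul_add, mul_one] at hz
    rw [← hz]
    abel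
  · intro x hx
    rw [mem_ker_dd i j hj]
    let f : (Gam i j)ᵐᵒᵖ →+* (B ⧸ Ring.jacobson B)ᵐᵒᵖ :=
      ((Ideal.Quotient.mk (Ring.jacobson B)).comp (TrivSqZeroExt.fstHom k B (Bim i j)).toRingHom).op
    have hf : Function.Surjective f := by
      intro y
      obtain ⟨a, ha⟩ := Ideal.Quotient.mk_surjective y.unop
      exact ⟨MulOpposite.op (mkG i j a 0), MulOpposite.unop_injective ha⟩
    have : RingHomSurjective f := ⟨hf⟩
    have h1 := Module.le_comap_jacobson f.toSemilinearMap hx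
    rw [IsSemisimpleModule.jacobson_eq_bot] at h1
    have h2 : f x = 0 := h1
    exact Ideal.Quotient.eq_zero_iff_mem.1 (congrArg MulOpposite.unop h2)

open DerivedCategory in
theorem claim1 [FiniteDimensional k B] [FiniteDimensional k T]
    (p : T →+ T) (hp1 : ∀ t a, p (t * j a) = p t * j a)
    (hp2 : ∀ a ∈ Ring.jacobson B, ∀ t, p (i a * t) = 0)
    (hp3 : ∀ t, ∃ a, j a = p t) (hp4 : ∀ a, p (j a) = j a)
    [HasDerivedCategory.{w} (ModuleCat.{u} (Gam i j)ᵐᵒᵖ)]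
    {S : Set (DerivedCategory (ModuleCat.{u} (Gam i j)ᵐᵒᵖ))} (hS : IsColoc S)
    (hP : ∀ M : ModuleCat.{u} (Gam i j)ᵐᵒᵖ, Projective M → (singleFunctor _ 0).obj M ∈ S)
    (X : DerivedCategory (ModuleCat.{u} (Gam i j)ᵐᵒᵖ)) : X ∈ S := by
  have hB : IsArtinianRing B := IsArtinianRing.of_finite k _
  refine hS.main ?_ X
  let π : LinearMap.ker (dd i j) →ₗ[(Gam i j)ᵐᵒᵖ] LinearMap.range (dd i j) :=
    { toFun x := ⟨MulOpposite.op (mkG i j 0 (p (sn i j x.1.unop))), by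
        obtain ⟨a, ha⟩ := hp3 (sn i j x.1.unop)
        refine ⟨MulOpposite.op (mkG i j a 0), ?_⟩
        rw [dd_apply, ← ha]
        rfl⟩
      map_add' x y := by
        apply Subtype.ext
        apply MulOpposite.unop_injective
        apply ext_G
        · exact (add_zero (0 : B)).symm
        · exact p.map_add _ _
      map_smul' r x := by
        apply Subtype.ext
        apply MulOpposite.unop_injective
        apply ext_G
        · exact (zero_mul _).symm
        · have hx := (mem_ker_dd i j hj x.1).1 x.2
          change p (i x.1.unop.fst * sn i j r.unop + sn i j x.1.unop * j r.unop.fst) =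
            i 0 * sn i j r.unop + p (sn i j x.1.unop) * j r.unop.fst
          rw [map_add, hp1, hp2 _ hx, map_zero, zero_mul] }
  have h1 := hS.range_mem hP (dd i j) (dd_dd i j) π (fun x => by
    apply MulOpposite.unop_injective
    simp only [dd_apply]
    apply ext_G
    · rfl
    · exact hp4 _)
  let e := (Submodule.quotEquivOfEq _ _ (ker_dd i j hj).symm).trans (dd i j).quotKerEquivRange
  exact hS.single_retract (M := ModuleCat.of _ _) (N := ModuleCat.of _ _)
    e.toLinearMap e.symm.toLinearMap (fun x => e.symm_apply_apply x) h1

end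
end PCG

namespace PCG
section
open TensorProduct

theorem exists_T (k B : Type u) [Field k] [Ring B] [Algebra k B] [FiniteDimensional k B] [Nontrivial B] :
    ∃ (T : Type u) (_ : Ring T) (_ : Algebra k T) (i j : B →ₐ[k] T),
      FiniteDimensional k T ∧ (∀ a, j a = 0 ↔ a ∈ Ring.jacobson B) ∧
      Module.Projective B (Bim i j) ∧
      ∃ (p : T →+ T), (∀ t a, p (t * j a) = p t * j a) ∧
        (∀ a ∈ Ring.jacobson B, ∀ t, p (i a * t) = 0) ∧
        (∀ t, ∃ a, j a = p t) ∧ (∀ a, p (j a) = j a) := by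
  have hB : IsArtinianRing B := IsArtinianRing.of_finite k _
  let J := Ring.jacobson B
  have hJ : J ≠ ⊤ := (Module.jacobson_lt_top B B).ne
  have hnt : Nontrivial (B ⧸ J) := Ideal.Quotient.nontrivial_iff.2 hJ
  let i : B →ₐ[k] B ⊗[k] (B ⧸ J) := Algebra.TensorProduct.includeLeft
  let mk : B →ₐ[k] B ⧸ J := Ideal.Quotient.mkₐ k J
  let inr : (B ⧸ J) →ₐ[k] B ⊗[k] (B ⧸ J) := Algebra.TensorProduct.includeRight
  let j : B →ₐ[k] B ⊗[k] (B ⧸ J) := inr.comp mk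
  obtain ⟨f, hf⟩ := LinearMap.exists_leftInverse_of_injective
    (LinearMap.toSpanSingleton k (B ⧸ J) 1) (LinearMap.ker_toSpanSingleton k (one_ne_zero))
  have hf1 : f 1 = 1 := by
    have := congr($hf 1)
    simpa using this
  let l : B →ₗ[k] k := f ∘ₗ mk.toLinearMap
  let q : B ⊗[k] (B ⧸ J) →ₗ[k] B ⧸ J := (TensorProduct.lid k _).toLinearMap ∘ₗ (LinearMap.rTensor _ l)
  have hq : ∀ a s, q (a ⊗ₜ s) = l a • s := fun a s => by simp [q]
  have hq1 : ∀ s, q (inr s) = s := by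
    intro s
    change q (1 ⊗ₜ s) = s
    rw [hq]
    simp [l, hf1]
  have hlJ : ∀ a ∈ J, l a = 0 := by
    intro a ha
    have : mk a = 0 := Ideal.Quotient.eq_zero_iff_mem.2 ha
    simp [l, this]
  refine ⟨B ⊗[k] (B ⧸ J), inferInstance, inferInstance, i, j, inferInstance, ?_, ?_,
    (inr.toLinearMap ∘ₗ q).toAddMonoidHom, ?_, ?_, ?_, ?_⟩
  · intro a
    have h1 : mk a = 0 ↔ a ∈ J := Ideal.Quotient.eq_zero_iff_mem
    rw [← h1]
    constructor
    · intro h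
      rw [← hq1 (mk a)]
      change q (j a) = 0
      rw [h, map_zero]
    · intro h
      change inr (mk a) = 0
      rw [h, map_zero]
  · let e : B ⊗[k] (B ⧸ J) ≃ₗ[B] Bim i j :=
      { toFun x := x
        invFun x := x
        left_inv _ := rfl
        right_inv _ := rfl
        map_add' _ _ := rfl
        map_smul' a t := by
          change a • t = i a * t
          induction t with
          | zero => simp
          | add x y hx hy => rw [smul_add, hx, hy, mul_add]
          | tmul x y => 
            change _ = (a ⊗ₜ 1) * (x ⊗ₜ y)
            rw [Algebra.TensorProduct.tmul_mul_tmul, one_mul]; rfl }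
    exact Module.Projective.of_equiv e
  · intro t a
    change inr (q (t * j a)) = inr (q t) * inr (mk a)
    rw [← map_mul]
    congr 1
    induction t with
    | zero => simp
    | add x y hx hy => rw [add_mul, map_add, hx, hy, map_add, add_mul]
    | tmul x y => 
      change q ((x ⊗ₜ y) * (1 ⊗ₜ mk a)) = _
      rw [Algebra.TensorProduct.tmul_mul_tmul, hq, hq, mul_one, smul_mul_assoc]
  · intro a ha t
    change inr (q (i a * t)) = 0
    have : q (i a * t) = 0 := by
      induction t with
      | zero => simp
      | add x y hx hy => rw [mul_add, map_add, hx, hy, add_zero]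
      | tmul x y => 
        change q ((a ⊗ₜ 1) * (x ⊗ₜ y)) = _
        rw [Algebra.TensorProduct.tmul_mul_tmul, hq, hlJ _ (J.mul_mem_right x ha), zero_smul]
    rw [this, map_zero]
  · intro t
    obtain ⟨a, ha⟩ := Ideal.Quotient.mk_surjective (q t)
    exact ⟨a, congrArg inr ha⟩
  · intro a
    exact congrArg inr (hq1 _)
end
end PCG

namespace PCG
section
variable {A A' : Type u} [Ring A] [Ring A'] (φ : A →+* A')
open DerivedCategory

instance : PreservesFiniteLimits (ModuleCat.restrictScalars.{u} φ) := by
  have key : ∀ (S : ShortComplex (ModuleCat.{u} A')), S.ShortExact →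
      (S.map (ModuleCat.restrictScalars.{u} φ)).ShortExact := ?_
  · have := (((ModuleCat.restrictScalars.{u} φ).exact_tfae.out 0 3 :
      _ ↔ PreservesFiniteLimits _ ∧ PreservesFiniteColimits _)).1 key
    exact this.1
  intro S hS
  have h1 := hS.moduleCat_injective_f
  have h2 := hS.moduleCat_surjective_g
  refine ModuleCat.shortComplex_shortExact _ ?_ h1 h2
  exact (ShortComplex.ShortExact.moduleCat_exact_iff_function_exact S).1 hS.exact

/-- the functor on complexes -/
noncomputable abbrev rC : Cx A' ⥤ Cx A :=
  (ModuleCat.restrictScalars.{u} φ).mapHomologicalComplex (ComplexShape.up ℤ)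

lemma proj_restrict (h : @Module.Projective A _ A' _ (Module.compHom A' φ))
    (M : ModuleCat.{u} A') [hM : Projective M] : Projective ((ModuleCat.restrictScalars φ).obj M) := by
  have hM' : Module.Projective A' M := (IsProjective.iff_projective M).2 hM
  let _ : Module A A' := Module.compHom A' φ
  let _ : Module A M := Module.compHom M φ
  have : IsScalarTower A A' M := ⟨fun a b m => mul_smul (φ a) b m⟩
  have : IsScalarTower A A' A' := ⟨fun a b m => mul_smul (φ a) b m⟩
  obtain ⟨s, hs⟩ := hM'.out
  have hA : Module.Projective A A' := h
  have hF : Module.Projective A (M →₀ A') := by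
    classical
    have : Module.Projective A (Π₀ _ : M, A') := inferInstance
    exact Module.Projective.of_equiv (finsuppLequivDFinsupp (ι := M) (M := A') A).symm
  have : Module.Projective A M :=
    Module.Projective.of_split (s.restrictScalars A)
      ((Finsupp.linearCombination A' (id : M → M)).restrictScalars A) (LinearMap.ext hs)
  exact (IsProjective.iff_projective (R := A) (M : Type u)).1 this

lemma isIso_of_bij {K L : Cx A} (f : K ⟶ L) (hb : ∀ i, Function.Bijective (f.f i)) : IsIso f := by
  have : ∀ i, IsIso (f.f i) := fun i => (ConcreteCategory.isIso_iff_bijective _).2 (hb i)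
  exact HomologicalComplex.Hom.isIso_of_components f

theorem claim2 [HasDerivedCategory.{w} (ModuleCat.{u} A)] [HasDerivedCategory.{w} (ModuleCat.{u} A')]
    (ρ : A' →+* A) (hρ : ∀ a, ρ (φ a) = a)
    (h : @Module.Projective A _ A' _ (Module.compHom A' φ))
    (hA' : ∀ S : Set (DerivedCategory (ModuleCat.{u} A')), IsColoc S →
      (∀ M : ModuleCat.{u} A', Projective M → (singleFunctor _ 0).obj M ∈ S) → ∀ X, X ∈ S)
    (S : Set (DerivedCategory (ModuleCat.{u} A))) (hS : IsColoc S)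
    (hP : ∀ M : ModuleCat.{u} A, Projective M → (singleFunctor _ 0).obj M ∈ S)
    (X : DerivedCategory (ModuleCat.{u} A)) : X ∈ S := by
  let F := (ModuleCat.restrictScalars.{u} φ).mapDerivedCategory
  let eF : ∀ K : Cx A', F.obj (Q.obj K) ≅ Q.obj ((rC φ).obj K) := fun K =>
    (ModuleCat.restrictScalars.{u} φ).mapDerivedCategoryFactors.app K
  have key : ∀ Y, F.obj Y ∈ S := by
    refine hA' {Y | F.obj Y ∈ S} ⟨?_, ?_, ?_, ?_⟩ ?_
    · intro X Y e hX
      exact hS.iso _ _ (F.mapIso e) hX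
    · intro X hX m
      exact hS.iso _ _ ((F.commShiftIso m).symm.app X) (hS.shift _ hX m)
    · intro T hT h1 h3
      exact hS.ext _ (F.map_distinguished T hT) h1 h3
    · intro I f c hc hf
      let K : I → Cx A' := fun a => Q.objPreimage (f a)
      let e : ∀ a, Q.obj (K a) ≅ f a := fun a => Q.objObjPreimageIso (f a)
      let e' : c.pt ≅ Q.obj (piC K) :=
        IsLimit.conePointsIsoOfNatIso hc (piFanIsLimit K) (Discrete.natIso fun a => (e a.as).symm)
      refine hS.iso _ _ ((F.mapIso e').trans (eF _)).symm ?_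
      let g : (rC φ).obj (piC K) ⟶ piC (fun a => (rC φ).obj (K a)) :=
        piLift _ fun a => (rC φ).map (piProj K a)
      have hg : IsIso g := isIso_of_bij g fun i => Function.bijective_id
      refine (hS.quasi g inferInstance).2 (hS.pi _ fun a => ?_)
      exact hS.iso _ _ ((F.mapIso (e a)).symm.trans (eF (K a))) (hf a)
    · intro M hM
      exact hS.iso _ _ (((ModuleCat.restrictScalars.{u} φ).mapDerivedCategorySingleFunctor 0).app M).symm
        (hP _ (proj_restrict φ h M))
  let K : Cx A := Q.objPreimage X
  let g : (rC φ).obj ((rC ρ).obj K) ⟶ K :=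
    { f i := ModuleCat.ofHom (X := (ModuleCat.restrictScalars φ).obj ((ModuleCat.restrictScalars ρ).obj (K.X i)))
        (Y := K.X i)
        { toFun x := x
          map_add' _ _ := rfl
          map_smul' a x := congrArg (fun b : A => b • (show K.X i from x)) (hρ a) }
      comm' i j _ := rfl }
  have hg : IsIso g := isIso_of_bij g fun i => Function.bijective_id
  exact hS.iso _ _ ((eF ((rC ρ).obj K)).trans ((asIso (Q.map g)).trans (Q.objObjPreimageIso X))) (key _)

end
end PCG

namespace PCG
section
open DerivedCategory

lemma pc_iff (L : Type u) [Ring L] : ProjectivesCogenerate L ↔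
    letI : HasDerivedCategory (ModuleCat.{u} Lᵐᵒᵖ) := HasDerivedCategory.standard _
    ∀ S : Set (DerivedCategory (ModuleCat.{u} Lᵐᵒᵖ)), IsColoc S →
      (∀ M : ModuleCat.{u} Lᵐᵒᵖ, Projective M → (singleFunctor _ 0).obj M ∈ S) → ∀ X, X ∈ S :=
  letI : HasDerivedCategory (ModuleCat.{u} Lᵐᵒᵖ) := HasDerivedCategory.standard _
  ⟨fun h S hS hP => h S hS.iso hS.shift hS.ext hS.prod hP,
    fun h S h1 h2 h3 h4 hP => h S ⟨h1, h2, h3, h4⟩ hP⟩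

lemma proj_Gam {k B T : Type u} [Field k] [Ring B] [Algebra k B] [Ring T] [Algebra k T]
    (i j : B →ₐ[k] T) (h : Module.Projective B (Bim i j)) :
    @Module.Projective B _ (Gam i j)ᵐᵒᵖᵐᵒᵖ _ (Module.compHom (Gam i j)ᵐᵒᵖᵐᵒᵖ
      ((RingEquiv.opOp (Gam i j)).toRingHom.comp (TrivSqZeroExt.inlHom B (Bim i j)))) := by
  let _ : Module B (Gam i j)ᵐᵒᵖᵐᵒᵖ := Module.compHom (Gam i j)ᵐᵒᵖᵐᵒᵖ
      ((RingEquiv.opOp (Gam i j)).toRingHom.comp (TrivSqZeroExt.inlHom B (Bim i j)))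
  let e : (B × Bim i j) ≃ₗ[B] (Gam i j)ᵐᵒᵖᵐᵒᵖ :=
    { toFun x := MulOpposite.op (MulOpposite.op x)
      invFun x := x.unop.unop
      left_inv _ := rfl
      right_inv _ := rfl
      map_add' _ _ := rfl
      map_smul' a x := by
        apply MulOpposite.unop_injective
        apply MulOpposite.unop_injective
        refine TrivSqZeroExt.ext rfl ?_
        change a • x.2 = a • x.2 + MulOpposite.op x.1 • (0 : Bim i j)
        rw [smul_zero, add_zero] }
  exact Module.Projective.of_equiv e

theorem pc_all
    (hsym : ∀ (k L : Type u) [Field k] [Ring L] [Algebra k L] [FiniteDimensional k L],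
      ProjectivesCogenerate L → ProjectivesCogenerate Lᵐᵒᵖ)
    (k L : Type u) [Field k] [Ring L] [Algebra k L] [FiniteDimensional k L] :
    ProjectivesCogenerate L := by
  rw [pc_iff]
  intro S hS hP X
  rcases subsingleton_or_nontrivial Lᵐᵒᵖ with hL | hL
  · let _ : HasDerivedCategory (ModuleCat.{u} Lᵐᵒᵖ) := HasDerivedCategory.standard _
    refine hS.iso _ _ (Q.objObjPreimageIso X) (hS.zero _ ?_)
    apply Functor.map_isZero
    rw [IsZero.iff_id_eq_zero]
    refine HomologicalComplex.Hom.ext (funext fun n => ModuleCat.hom_ext (LinearMap.ext fun x => ?_))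
    have := Module.subsingleton Lᵐᵒᵖ ((Q.objPreimage X).X n)
    exact Subsingleton.elim _ _
  · obtain ⟨T, _, _, i, j, hT, hj, hproj, p, h1, h2, h3, h4⟩ := exists_T k Lᵐᵒᵖ
    have hG : ProjectivesCogenerate (Gam i j) := by
      rw [pc_iff]
      intro S hS hP X
      let _ : HasDerivedCategory (ModuleCat.{u} (Gam i j)ᵐᵒᵖ) := HasDerivedCategory.standard _
      exact claim1 i j hj p h1 h2 h3 h4 hS hP X
    have hG' := (pc_iff _).1 (hsym k (Gam i j) hG)
    let _ : HasDerivedCategory (ModuleCat.{u} Lᵐᵒᵖ) := HasDerivedCategory.standard _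
    let _ : HasDerivedCategory (ModuleCat.{u} (Gam i j)ᵐᵒᵖᵐᵒᵖ) := HasDerivedCategory.standard _
    exact claim2 ((RingEquiv.opOp (Gam i j)).toRingHom.comp (TrivSqZeroExt.inlHom Lᵐᵒᵖ (Bim i j)))
      ((TrivSqZeroExt.fstHom k Lᵐᵒᵖ (Bim i j)).toRingHom.comp (RingEquiv.opOp (Gam i j)).symm.toRingHom)
      (fun a => rfl) (proj_Gam i j hproj) hG' S hS hP X
end
end PCG

/-- **Theorem.** Projectives cogenerate for all finite dimensional algebras if and
only if, for all finite dimensional algebras `Λ`, projectives cogenerate for `Λ`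
implies that projectives cogenerate for `Λᵒᵖ`. -/
theorem projectives_cogenerate_iff_left_right_symmetric :
    (∀ (k Λ : Type u) [Field k] [Ring Λ] [Algebra k Λ] [FiniteDimensional k Λ],
      ProjectivesCogenerate Λ) ↔
    (∀ (k Λ : Type u) [Field k] [Ring Λ] [Algebra k Λ] [FiniteDimensional k Λ],
      ProjectivesCogenerate Λ → ProjectivesCogenerate Λᵐᵒᵖ) := by
  constructor
  · intro h k L _ _ _ _ _
    exact h k Lᵐᵒᵖ
  · intro h k L _ _ _ _
    exact PCG.pc_all h k L
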